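/- arXiv:2601.19467 — 6 statements merged into one kernel-verified Lean document; each statement's English description precedes it below -/
import Mathlib

section
/- Let d ∈ ℕ, let g, b : Fin d → ℝ with g i ≥ 0 for all i, and let h : ℕ → (Fin d → ℝ) satisfy h (n+1) i = g i * h n i + b i for all n ∈ ℕ and all i : Fin d. If the range of h (the set {h n : n ∈ ℕ} of vectors) is finite, then there exists N ∈ ℕ such that h n = h N for all n ≥ N. -/
/-- An orbit of a monotone self-map of a linear order is monotone or antitone. -/
theorem monotone_or_antitone_of_succ_eq {α : Type*} [LinearOrder α] {f : α → α}
    (hf : Monotone f) {x : ℕ → α} (hx : ∀ n, x (n + 1) = f (x n)) :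
    Monotone x ∨ Antitone x := by
  rcases le_total (x 0) (x 1) with h01 | h01
  · refine Or.inl (monotone_nat_of_le_succ fun n => ?_)
    induction n with
    | zero => exact h01
    | succ k ih => rw [hx k, hx (k + 1)]; exact hf ih
  · refine Or.inr (antitone_nat_of_succ_le fun n => ?_)
    induction n with
    | zero => exact h01
    | succ k ih => rw [hx k, hx (k + 1)]; exact hf ih

/-- An orbit of a monotone self-map of a linear order which returns to a point fixes it. -/
theorem succ_eq_of_orbit_eq {α : Type*} [LinearOrder α] {f : α → α}
    (hf : Monotone f) {x : ℕ → α} (hx : ∀ n, x (n + 1) = f (x n))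
    {m n : ℕ} (hmn : m < n) (h : x m = x n) : x (m + 1) = x m := by
  rcases monotone_or_antitone_of_succ_eq hf hx with hm | hm
  · exact le_antisymm ((hm hmn).trans h.ge) (hm m.le_succ)
  · exact le_antisymm (hm m.le_succ) (h.le.trans (hm hmn))

theorem diag_vector_recurrence_stabilises (d : ℕ) (g b : Fin d → ℝ)
    (hg : ∀ i : Fin d, 0 ≤ g i) (h : ℕ → (Fin d → ℝ))
    (hrec : ∀ (n : ℕ) (i : Fin d), h (n + 1) i = g i * h n i + b i)
    (hfin : (Set.range h).Finite) :
    ∃ N : ℕ, ∀ n : ℕ, N ≤ n → h n = h N := by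
  obtain ⟨m, n, hmn, heq⟩ := hfin.exists_lt_map_eq_of_forall_mem (Set.mem_range_self (f := h))
  have hfix : h (m + 1) = h m := by
    funext i
    have hmono : Monotone fun y : ℝ => g i * y + b i :=
      (monotone_id.const_mul (hg i)).add_const (b i)
    exact succ_eq_of_orbit_eq (x := fun k => h k i) hmono (fun k => hrec k i) hmn
      (congrFun heq i)
  refine ⟨m, fun k hk => ?_⟩
  induction k, hk using Nat.le_induction with
  | base => rfl
  | succ k _ ih =>
    rw [← hfix]
    funext i
    rw [hrec, hrec, ih]
end

section
/- Define relu : ℝ → ℝ by relu x = max x 0. For every integer b and every integer x (both regarded as real numbers via the canonical coercion), relu (relu (x - (b - 1)) - 2 * relu (x - b)) equals 1 if x = b and equals 0 otherwise. -/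
def relu (x : ℝ) : ℝ := max x 0

theorem relu_eq_gadget (b x : ℤ) :
    relu (relu ((x : ℝ) - ((b : ℝ) - 1)) - 2 * relu ((x : ℝ) - (b : ℝ))) =
      if x = b then 1 else 0 := by
  unfold relu
  rcases lt_trichotomy x b with h | rfl | h
  · have hx : (x : ℝ) + 1 ≤ b := by exact_mod_cast h
    rw [if_neg h.ne, max_eq_right (by linarith : (x : ℝ) - (b - 1) ≤ 0),
      max_eq_right (by linarith : (x : ℝ) - b ≤ 0)]
    simp
  · simp
  · have hx : (b : ℝ) + 1 ≤ x := by exact_mod_cast h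
    rw [if_neg h.ne', max_eq_left (by linarith : 0 ≤ (x : ℝ) - (b - 1)),
      max_eq_left (by linarith : 0 ≤ (x : ℝ) - b)]
    exact max_eq_right (by linarith)
end

section
/- Let a : ℕ → ℝ be a sequence with a i ∈ {0, 1} for all i, and let h : ℕ → ℝ satisfy h 0 = 0 and h t = (1/4) * h (t-1) + a t for all t ≥ 1. Then for every t ≥ 2, a t + (1/4) * a (t-1) ≤ h t ≤ a t + (1/4) * a (t-1) + 1/12; moreover 0 ≤ h t ≤ 4/3 for all t ≥ 1. -/
theorem yesterday_encoding_localisation (a : ℕ → ℝ)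
    (ha : ∀ i : ℕ, a i ∈ ({0, 1} : Set ℝ)) (h : ℕ → ℝ)
    (h0 : h 0 = 0)
    (hrec : ∀ t : ℕ, 1 ≤ t → h t = (1 / 4) * h (t - 1) + a t) :
    (∀ t : ℕ, 2 ≤ t →
      a t + (1 / 4) * a (t - 1) ≤ h t ∧ h t ≤ a t + (1 / 4) * a (t - 1) + 1 / 12) ∧
    (∀ t : ℕ, 1 ≤ t → 0 ≤ h t ∧ h t ≤ 4 / 3) := by
  have hsucc (t : ℕ) : h (t + 1) = (1 / 4) * h t + a (t + 1) := hrec (t + 1) (by omega)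
  have hbound (t : ℕ) : 0 ≤ h t ∧ h t ≤ 4 / 3 := by
    induction t with
    | zero => norm_num [h0]
    | succ t ih =>
      obtain ⟨hl, hu⟩ := ih
      rw [hsucc t]
      rcases ha (t + 1) with h1 | h1 <;> rw [h1] <;> constructor <;> linarith
  refine ⟨fun t ht => ?_, fun t _ => hbound t⟩
  obtain ⟨s, rfl⟩ := Nat.exists_eq_add_of_le' ht
  obtain ⟨hl, hu⟩ := hbound s
  rw [show s + 2 - 1 = s + 1 from rfl, hsucc (s + 1), hsucc s]
  constructor <;> linarith
end

section
/- Let a : ℕ → ℝ be a sequence with a i ∈ {0, 1} for all i, and let h : ℕ → ℝ satisfy h 0 = 0 and h t = (1/4) * h (t-1) + a t for all t ≥ 1. Then for every t ≥ 1, the floor of h t (as an integer) equals a t; that is, the integer part of the encoding recovers the current input bit. -/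
theorem mem_Icc_of_quarter_recurrence {a h : ℕ → ℝ} (ha : ∀ i, a i ∈ Set.Icc (0 : ℝ) 1)
    (h0 : h 0 = 0) (hrec : ∀ t, 1 ≤ t → h t = (1 / 4) * h (t - 1) + a t) (t : ℕ) :
    h t ∈ Set.Icc (0 : ℝ) (4 / 3) := by
  induction t with
  | zero => norm_num [h0]
  | succ n ih =>
    have hn := hrec (n + 1) (Nat.le_add_left 1 n)
    rw [Nat.add_sub_cancel] at hn
    obtain ⟨hl, hu⟩ := ih
    obtain ⟨al, au⟩ := ha (n + 1)
    constructor <;> linarith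

theorem yesterday_encoding_floor (a : ℕ → ℝ)
    (ha : ∀ i : ℕ, a i ∈ ({0, 1} : Set ℝ)) (h : ℕ → ℝ)
    (h0 : h 0 = 0)
    (hrec : ∀ t : ℕ, 1 ≤ t → h t = (1 / 4) * h (t - 1) + a t) :
    ∀ t : ℕ, 1 ≤ t → ((⌊h t⌋ : ℝ) = a t) := by
  intro t ht
  have ha' : ∀ i, a i ∈ Set.Icc (0 : ℝ) 1 := fun i => by
    rcases ha i with hi | hi <;> norm_num [show a i = _ from hi]
  obtain ⟨hl, hu⟩ := mem_Icc_of_quarter_recurrence ha' h0 hrec (t - 1)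
  have hfrac : ⌊(1 / 4) * h (t - 1)⌋ = 0 :=
    Int.floor_eq_zero_iff.mpr ⟨by linarith, by linarith⟩
  rw [hrec t ht]
  rcases ha t with hat | hat
  · rw [hat, add_zero, hfrac, Int.cast_zero]
  · rw [show a t = 1 from hat, Int.floor_add_one, hfrac]
    norm_num
end

section
/- Let a, a' : ℕ → ℝ be sequences with a i ∈ {0, 1} and a' i ∈ {0, 1} for all i, and let h, h' : ℕ → ℝ satisfy h 0 = h' 0 = 0, h t = (1/4) * h (t-1) + a t and h' t = (1/4) * h' (t-1) + a' t for all t ≥ 1. Then for all t, s ≥ 2, if a (t-1) ≠ a' (s-1), then |h t - h' s| ≥ 1/6. -/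
/-- Encodings of binary sequences stay in the interval `[0, 4/3]`. -/
theorem binary_encoding_mem_Icc (a : ℕ → ℝ) (ha : ∀ i : ℕ, a i ∈ ({0, 1} : Set ℝ))
    (h : ℕ → ℝ) (h0 : h 0 = 0)
    (hrec : ∀ t : ℕ, 1 ≤ t → h t = (1 / 4) * h (t - 1) + a t) (t : ℕ) :
    h t ∈ Set.Icc (0 : ℝ) (4 / 3) := by
  induction t with
  | zero => rw [h0]; norm_num
  | succ n ih =>
    have hn := hrec (n + 1) (by omega)
    rw [Nat.add_sub_cancel] at hn
    obtain ⟨hl, hu⟩ := ih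
    rcases ha (n + 1) with e | e <;> rw [e] at hn <;> constructor <;> linarith

theorem yesterday_encoding_separation (a a' : ℕ → ℝ)
    (ha : ∀ i : ℕ, a i ∈ ({0, 1} : Set ℝ)) (ha' : ∀ i : ℕ, a' i ∈ ({0, 1} : Set ℝ))
    (h h' : ℕ → ℝ) (h0 : h 0 = 0) (h0' : h' 0 = 0)
    (hrec : ∀ t : ℕ, 1 ≤ t → h t = (1 / 4) * h (t - 1) + a t)
    (hrec' : ∀ t : ℕ, 1 ≤ t → h' t = (1 / 4) * h' (t - 1) + a' t) :
    ∀ t s : ℕ, 2 ≤ t → 2 ≤ s → a (t - 1) ≠ a' (s - 1) → 1 / 6 ≤ |h t - h' s| := by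
  intro t s ht hs hne
  obtain ⟨hl, hu⟩ := binary_encoding_mem_Icc a ha h h0 hrec (t - 1 - 1)
  obtain ⟨hl', hu'⟩ := binary_encoding_mem_Icc a' ha' h' h0' hrec' (s - 1 - 1)
  have e₁ := hrec t (by omega)
  have e₂ := hrec (t - 1) (by omega)
  have e₁' := hrec' s (by omega)
  have e₂' := hrec' (s - 1) (by omega)
  rw [le_abs]
  rcases ha (t - 1) with p | p <;> rcases ha' (s - 1) with p' | p' <;>
    rw [p, p'] at hne <;> first | exact absurd rfl hne | skip
  all_goals
    rw [p] at e₂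
    rw [p'] at e₂'
    rcases ha t with q | q <;> rcases ha' s with q' | q' <;> rw [q] at e₁ <;> rw [q'] at e₁' <;>
      first | (left; linarith) | (right; linarith)
end

section
/- Let x, y : ℕ → ℝ be sequences with x t ∈ {0, 1} and y t ∈ {0, 1} for all t, and let h : ℕ → ℝ satisfy h 0 = 0 and h t = x t * h (t-1) + y t for all t ≥ 1. Then h t ≥ 0 for all t, and for every t ≥ 1: h t > 0 if and only if there exists k with 1 ≤ k ≤ t such that y k = 1 and x j = 1 for all j with k < j ≤ t. -/
/-- One-step unfolding of the temporal `since` operator. -/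
theorem since_succ_iff (p q : ℕ → Prop) (t : ℕ) :
    (∃ k : ℕ, 1 ≤ k ∧ k ≤ t + 1 ∧ q k ∧ ∀ j : ℕ, k < j → j ≤ t + 1 → p j) ↔
      q (t + 1) ∨
        p (t + 1) ∧ ∃ k : ℕ, 1 ≤ k ∧ k ≤ t ∧ q k ∧ ∀ j : ℕ, k < j → j ≤ t → p j := by
  constructor
  · rintro ⟨k, hk1, hkt, hq, hp⟩
    rcases hkt.eq_or_lt with rfl | hlt
    · exact Or.inl hq
    · exact Or.inr ⟨hp _ hlt le_rfl, k, hk1, by lia, hq, fun j hj hjt => hp j hj (by lia)⟩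
  · rintro (hq | ⟨hpt, k, hk1, hkt, hq, hp⟩)
    · exact ⟨t + 1, by lia, le_rfl, hq, fun j hj hjt => by lia⟩
    · refine ⟨k, hk1, by lia, hq, fun j hj hjt => ?_⟩
      rcases hjt.eq_or_lt with rfl | hlt
      · exact hpt
      · exact hp j hj (by lia)

theorem since_gate_correct (x y : ℕ → ℝ)
    (hx : ∀ t : ℕ, x t ∈ ({0, 1} : Set ℝ)) (hy : ∀ t : ℕ, y t ∈ ({0, 1} : Set ℝ))
    (h : ℕ → ℝ) (h0 : h 0 = 0)
    (hrec : ∀ t : ℕ, 1 ≤ t → h t = x t * h (t - 1) + y t) :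
    (∀ t : ℕ, 0 ≤ h t) ∧
    (∀ t : ℕ, 1 ≤ t →
      (0 < h t ↔ ∃ k : ℕ, 1 ≤ k ∧ k ≤ t ∧ y k = 1 ∧
        ∀ j : ℕ, k < j → j ≤ t → x j = 1)) := by
  have hsucc (t : ℕ) : h (t + 1) = x (t + 1) * h t + y (t + 1) := hrec (t + 1) (by lia)
  have hnonneg (t : ℕ) : 0 ≤ h t := by
    induction t with
    | zero => exact h0.ge
    | succ t ih =>
      rw [hsucc]
      rcases hx (t + 1) with hxt | hxt <;> rcases hy (t + 1) with hyt | hyt <;>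
        rw [hxt, hyt] <;> linarith
  refine ⟨hnonneg, fun t _ => ?_⟩
  induction t with
  | zero => lia
  | succ t ih =>
    have ih' : 0 < h t ↔ ∃ k : ℕ, 1 ≤ k ∧ k ≤ t ∧ y k = 1 ∧
        ∀ j : ℕ, k < j → j ≤ t → x j = 1 := by
      rcases t.eq_zero_or_pos with rfl | ht
      · simp only [h0, lt_irrefl, false_iff]
        rintro ⟨k, hk1, hk0, -⟩
        lia
      · exact ih ht
    rw [since_succ_iff (fun j => x j = 1) (fun k => y k = 1), ← ih', hsucc]
    have hpos : 0 < h t + 1 := by linarith [hnonneg t]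
    rcases hx (t + 1) with hxt | hxt <;> rcases hy (t + 1) with hyt | hyt <;>
      rw [hxt, hyt] <;> simp [hpos]
end
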